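/- With the notation of the context (endomorphisms of Λ*(ℝ⁴), real numbers a,b with ab≠0, real parameter h, and zeroth-order symbol p₀), one has tr[c̃(e₄)∘p₀∘c̃(e₄)∘ι(e₄)] = 6a²bh. -/

import Mathlib

open scoped BigOperators

noncomputable section

/-- The standard orthonormal basis vectors of `ℝ⁴`; `stdBasis 3` is `e₄`. -/
def stdBasis (i : Fin 4) : EuclideanSpace ℝ (Fin 4) := EuclideanSpace.single i 1

/-- Left exterior multiplication `ε(v)` on the exterior algebra `Λ*(ℝ⁴)`. -/
def eps (v : EuclideanSpace ℝ (Fin 4)) :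
    ExteriorAlgebra ℝ (EuclideanSpace ℝ (Fin 4)) →ₗ[ℝ]
      ExteriorAlgebra ℝ (EuclideanSpace ℝ (Fin 4)) :=
  LinearMap.mulLeft ℝ (ExteriorAlgebra.ι ℝ v)

/-- Interior multiplication (contraction) `ι(v)` with respect to the inner product. -/
def iot (v : EuclideanSpace ℝ (Fin 4)) :
    ExteriorAlgebra ℝ (EuclideanSpace ℝ (Fin 4)) →ₗ[ℝ]
      ExteriorAlgebra ℝ (EuclideanSpace ℝ (Fin 4)) :=
  CliffordAlgebra.contractLeft ((innerSL ℝ v).toLinearMap)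

/-- `c(v) = ε(v) - ι(v)`. -/
def cOp (v : EuclideanSpace ℝ (Fin 4)) := eps v - iot v

/-- `ĉ(v) = ε(v) + ι(v)`. -/
def cHat (v : EuclideanSpace ℝ (Fin 4)) := eps v + iot v

/-- `c̃(v) = a·ε(v) - b·ι(v)`. -/
def cTil (a b : ℝ) (v : EuclideanSpace ℝ (Fin 4)) := a • eps v - b • iot v

/-- The zeroth-order symbol
`p₀ = -(h/4)·Σᵢ c̃(eᵢ)∘ĉ(eᵢ)∘ĉ(e₄) + (h/4)·Σᵢ c̃(eᵢ)∘c(eᵢ)∘c(e₄)`. -/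
def p0 (a b h : ℝ) :
    ExteriorAlgebra ℝ (EuclideanSpace ℝ (Fin 4)) →ₗ[ℝ]
      ExteriorAlgebra ℝ (EuclideanSpace ℝ (Fin 4)) :=
  (-(h / 4)) • ∑ i : Fin 3,
      (cTil a b (stdBasis i.castSucc) ∘ₗ cHat (stdBasis i.castSucc) ∘ₗ cHat (stdBasis 3))
    + (h / 4) • ∑ i : Fin 3,
      (cTil a b (stdBasis i.castSucc) ∘ₗ cOp (stdBasis i.castSucc) ∘ₗ cOp (stdBasis 3))

abbrev ExtE := ExteriorAlgebra ℝ (EuclideanSpace ℝ (Fin 4))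

set_option linter.unusedSimpArgs false in
theorem key_alg {A : Type*} [Ring A] [Algebra ℝ A] (e i E I : A) (a b h : ℝ)
    (hee : e * e = 0) (hii : i * i = 0) (hEE : E * E = 0) (hII : I * I = 0)
    (hie : i * e = 1 - e * i) (hIE : I * E = 1 - E * I)
    (hEe : E * e = -(e * E)) (hEi : E * i = -(i * E))
    (hIe : I * e = -(e * I)) (hIi : I * i = -(i * I)) :
    (a • E - b • I) * ((-(h / 4)) • ((a • e - b • i) * ((e + i) * (E + I)))
      + (h / 4) • ((a • e - b • i) * ((e - i) * (E - I)))) * ((a • E - b • I) * I)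
      = (a ^ 2 * b * h / 2) • (i * e * (E * I)) := by
  have assoc {x y z : A} (hx : x * y = z) (w : A) : x * (y * w) = z * w := by
    rw [← mul_assoc, hx]
  have h1 := assoc hee
  have h2 := assoc hii
  have h3 := assoc hEE
  have h4 := assoc hII
  have h5 := assoc hie
  have h6 := assoc hIE
  have h7 := assoc hEe
  have h8 := assoc hEi
  have h9 := assoc hIe
  have h10 := assoc hIi
  simp only [mul_add, add_mul, mul_sub, sub_mul, smul_mul_assoc, mul_smul_comm, mul_assoc,
    hee, hii, hEE, hII, hie, hIE, hEe, hEi, hIe, hIi, h1, h2, h3, h4, h5, h6, h7, h8, h9, h10,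
    neg_mul, mul_neg, zero_mul, mul_zero, one_mul, mul_one, smul_zero, neg_zero, sub_zero,
    zero_sub, add_zero, zero_add, neg_neg]
  module

theorem eps_sq (v : EuclideanSpace ℝ (Fin 4)) : (eps v * eps v : Module.End ℝ ExtE) = 0 := by
  refine LinearMap.ext fun x => ?_
  simp [eps, ← mul_assoc]

theorem iot_sq (v : EuclideanSpace ℝ (Fin 4)) : (iot v * iot v : Module.End ℝ ExtE) = 0 :=
  LinearMap.ext fun x => CliffordAlgebra.contractLeft_contractLeft _ x

theorem eps_anti (v w : EuclideanSpace ℝ (Fin 4)) :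
    (eps v * eps w : Module.End ℝ ExtE) = -(eps w * eps v) := by
  have h := eps_sq (v + w)
  have h' : eps (v + w) = eps v + eps w := by
    refine LinearMap.ext fun x => ?_
    simp [eps, add_mul]
  rw [h', add_mul, mul_add, mul_add, eps_sq, eps_sq, zero_add, add_zero] at h
  exact eq_neg_of_add_eq_zero_left h

theorem iot_anti (v w : EuclideanSpace ℝ (Fin 4)) :
    (iot v * iot w : Module.End ℝ ExtE) = -(iot w * iot v) :=
  LinearMap.ext fun x => CliffordAlgebra.contractLeft_comm _ _ x

theorem iot_eps (v w : EuclideanSpace ℝ (Fin 4)) :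
    (iot v * eps w : Module.End ℝ ExtE) = (inner ℝ v w) • 1 - eps w * iot v :=
  LinearMap.ext fun x => CliffordAlgebra.contractLeft_ι_mul (Q := 0) _ w x

theorem inner_self_std (i : Fin 4) : inner ℝ (stdBasis i) (stdBasis i) = (1 : ℝ) := by
  simp [stdBasis]

theorem inner_ne_std (i j : Fin 4) (hij : i ≠ j) :
    inner ℝ (stdBasis i) (stdBasis j) = (0 : ℝ) := by
  simp [stdBasis, EuclideanSpace.inner_single_left, hij]

theorem trace_one_ext : LinearMap.trace ℝ ExtE 1 = 16 := by
  let B := (EuclideanSpace.basisFun (Fin 4) ℝ).toBasis.ExteriorAlgebra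
  have : Module.Finite ℝ ExtE := Module.Finite.of_basis B
  have : Module.Free ℝ ExtE := Module.Free.of_basis B
  rw [LinearMap.trace_one, Module.finrank_eq_card_basis B]
  simp

theorem aux_comm {A : Type*} [Ring A] (X Y y : A) (r3 : y * X = -(X * y))
    (r4 : Y * y = -(y * Y)) : X * Y * y = y * (X * Y) := by
  rw [mul_assoc, r4, mul_neg, ← mul_assoc, ← mul_assoc, r3, neg_mul]

theorem trace_quad (i : Fin 4) (hi : i ≠ 3) :
    LinearMap.trace ℝ ExtE (iot (stdBasis i) * eps (stdBasis i) *
      (eps (stdBasis 3) * iot (stdBasis 3))) = 4 := by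
  have r1 := iot_eps (stdBasis i) (stdBasis i)
  have r2 := iot_eps (stdBasis 3) (stdBasis 3)
  have r3 := iot_eps (stdBasis i) (stdBasis 3)
  rw [inner_self_std, one_smul] at r1 r2
  rw [inner_ne_std _ _ hi, zero_smul, zero_sub] at r3
  have r4 := iot_anti (stdBasis 3) (stdBasis i)
  have h1 := trace_one_ext
  revert r1 r2 r3 r4
  generalize (iot (stdBasis i) : Module.End ℝ ExtE) = y
  generalize (eps (stdBasis i) : Module.End ℝ ExtE) = x
  generalize (iot (stdBasis 3) : Module.End ℝ ExtE) = Y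
  generalize (eps (stdBasis 3) : Module.End ℝ ExtE) = X
  intro r1 r2 r3 r4
  have c1 : X * Y * y = y * (X * Y) := by
    exact aux_comm (A := Module.End ℝ ExtE) X Y y r3 r4
  have e1 : LinearMap.trace ℝ ExtE (x * y * (X * Y)) =
      LinearMap.trace ℝ ExtE (y * x * (X * Y)) := by
    rw [mul_assoc x, ← c1, LinearMap.trace_mul_comm, mul_assoc, LinearMap.trace_mul_comm]
  have e2 : LinearMap.trace ℝ ExtE (Y * X) = LinearMap.trace ℝ ExtE (X * Y) :=
    LinearMap.trace_mul_comm _ _ _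
  rw [r2, map_sub, h1] at e2
  have e3 : LinearMap.trace ℝ ExtE (y * x * (X * Y)) =
      LinearMap.trace ℝ ExtE (X * Y) - LinearMap.trace ℝ ExtE (x * y * (X * Y)) := by
    rw [r1, sub_mul, one_mul, map_sub]
  linarith

theorem trace_cTil_e4_p0_cTil_e4_iot_e4 (a b h : ℝ) (hab : a * b ≠ 0) :
    LinearMap.trace ℝ _ (cTil a b (stdBasis 3) ∘ₗ p0 a b h ∘ₗ cTil a b (stdBasis 3) ∘ₗ iot (stdBasis 3)) = 6 * a ^ 2 * b * h := by
  have hp : ∀ i : Fin 3, i.castSucc ≠ (3 : Fin 4) := by decide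
  have key : ∀ i : Fin 3, cTil a b (stdBasis 3) *
      ((-(h / 4)) • (cTil a b (stdBasis i.castSucc) *
          (cHat (stdBasis i.castSucc) * cHat (stdBasis 3)))
        + (h / 4) • (cTil a b (stdBasis i.castSucc) *
          (cOp (stdBasis i.castSucc) * cOp (stdBasis 3)))) *
      (cTil a b (stdBasis 3) * iot (stdBasis 3)) =
      (a ^ 2 * b * h / 2) • (iot (stdBasis i.castSucc) * eps (stdBasis i.castSucc) *
        (eps (stdBasis 3) * iot (stdBasis 3)) : Module.End ℝ ExtE) := by
    intro i
    refine key_alg (A := Module.End ℝ ExtE) _ _ _ _ a b h (eps_sq _) (iot_sq _) (eps_sq _)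
      (iot_sq _) ?_ ?_ (eps_anti _ _) ?_ ?_ (iot_anti _ _)
    · rw [iot_eps, inner_self_std, one_smul]
    · rw [iot_eps, inner_self_std, one_smul]
    · rw [iot_eps, inner_ne_std _ _ (hp i), zero_smul, zero_sub, neg_neg]
    · rw [iot_eps, inner_ne_std _ _ (hp i).symm, zero_smul, zero_sub]
  have tot : cTil a b (stdBasis 3) ∘ₗ p0 a b h ∘ₗ cTil a b (stdBasis 3) ∘ₗ iot (stdBasis 3) =
      ∑ i : Fin 3, (a ^ 2 * b * h / 2) •
        (iot (stdBasis i.castSucc) * eps (stdBasis i.castSucc) *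
        (eps (stdBasis 3) * iot (stdBasis 3)) : Module.End ℝ ExtE) := by
    rw [← Finset.sum_congr rfl fun i _ => key i, ← Finset.sum_mul, ← Finset.mul_sum,
      Finset.sum_add_distrib, ← Finset.smul_sum, ← Finset.smul_sum]
    rfl
  rw [tot, map_sum, Finset.sum_congr rfl fun i _ => by
    rw [map_smul, trace_quad _ (hp i)]]
  simp
  ring
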